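/- arXiv:0804.4576 — 2 statements merged into one kernel-verified Lean document; each statement's English description precedes it below -/
import Mathlib

section
/- Suppose line segments l₁ = [x₁, x₁+α₁e₁] and l₂ = [x₂, x₂+α₂e₂] in ℝ² (with e₁, e₂ unit vectors, α₁, α₂ > 0) intersect at a point x₃ with [x₃ − αe_m, x₃ + αe_m] ⊆ l_m for m = 1,2 and some α > 0. If x₁', x₂' ∈ ℝ² and unit vectors e₁', e₂' satisfy ‖x_m' − x_m‖ ≤ (α/16)|⟨e₂^⊥, e₁⟩| and ‖e_m' − e_m‖ ≤ (α/(8(α₁+α₂)))|⟨e₂^⊥, e₁⟩| for m = 1,2, then the segments l_m' = [x_m', x_m' + α_m e_m'] intersect at some point x₃' with ‖x₃' − x₃‖ ≤ α. -/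
/-- The Euclidean norm on the plane `ℝ × ℝ`. -/
noncomputable def eNorm (v : ℝ × ℝ) : ℝ := Real.sqrt (v.1 ^ 2 + v.2 ^ 2)

/-- The Euclidean inner product on the plane. -/
def eInner (v w : ℝ × ℝ) : ℝ := v.1 * w.1 + v.2 * w.2

/-- Rotation by a right angle: `e^⊥ = (−e², e¹)`. -/
def perp (e : ℝ × ℝ) : ℝ × ℝ := (-e.2, e.1)

theorem eNorm_eq_norm (v : ℝ × ℝ) : eNorm v = ‖(⟨v.1, v.2⟩ : ℂ)‖ := by
  rw [eNorm, Complex.norm_def, Complex.normSq_apply, sq, sq]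

theorem eNorm_nonneg (v : ℝ × ℝ) : 0 ≤ eNorm v := Real.sqrt_nonneg _

theorem eNorm_zero : eNorm 0 = 0 := by simp [eNorm]

theorem eNorm_add_le (v w : ℝ × ℝ) : eNorm (v + w) ≤ eNorm v + eNorm w := by
  simp only [eNorm_eq_norm]
  exact norm_add_le (⟨v.1, v.2⟩ : ℂ) ⟨w.1, w.2⟩

theorem eNorm_neg (v : ℝ × ℝ) : eNorm (-v) = eNorm v := by simp [eNorm]

theorem eNorm_smul (t : ℝ) (v : ℝ × ℝ) : eNorm (t • v) = |t| * eNorm v := by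
  rw [eNorm, eNorm, ← Real.sqrt_sq_eq_abs, ← Real.sqrt_mul (sq_nonneg t)]
  congr 1
  simp only [Prod.smul_fst, Prod.smul_snd, smul_eq_mul]
  ring

theorem eNorm_perp (v : ℝ × ℝ) : eNorm (perp v) = eNorm v := by
  simp [eNorm, perp, add_comm]

theorem abs_eInner_le (v w : ℝ × ℝ) : |eInner v w| ≤ eNorm v * eNorm w := by
  rw [eNorm, eNorm, ← Real.sqrt_mul (by positivity)]
  apply Real.abs_le_sqrt
  rw [eInner]
  nlinarith [sq_nonneg (v.1 * w.2 - v.2 * w.1)]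

theorem eq_zero_of_eNorm_le_zero {v : ℝ × ℝ} (h : eNorm v ≤ 0) : v = 0 := by
  have h0 := (Real.sqrt_eq_zero (by positivity)).1 (le_antisymm h (eNorm_nonneg v))
  ext
  · simp only [Prod.fst_zero]; nlinarith [sq_nonneg v.1, sq_nonneg v.2]
  · simp only [Prod.snd_zero]; nlinarith [sq_nonneg v.1, sq_nonneg v.2]

theorem mem_segment_add_smul {x e : ℝ × ℝ} {β t : ℝ} (hβ : 0 < β) (h₀ : 0 ≤ t) (h₁ : t ≤ β) :
    x + t • e ∈ segment ℝ x (x + β • e) := by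
  rw [segment_eq_image']
  refine ⟨t / β, ⟨by positivity, (div_le_one hβ).2 h₁⟩, ?_⟩
  simp only [add_sub_cancel_left, smul_smul, div_mul_cancel₀ _ hβ.ne']

theorem exists_eq_add_smul_of_segment_subset {x e z : ℝ × ℝ} {β a : ℝ} (hβ : 0 < β)
    (he : eNorm e = 1) (h : segment ℝ (z - a • e) (z + a • e) ⊆ segment ℝ x (x + β • e)) :
    ∃ t, z = x + t • e ∧ a ≤ t ∧ t ≤ β - a := by
  have hl := h (left_mem_segment ℝ _ _)
  have hr := h (right_mem_segment ℝ _ _)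
  rw [segment_eq_image'] at hl hr
  obtain ⟨θ, ⟨hθ₀, -⟩, hθ⟩ := hl
  obtain ⟨η, ⟨-, hη₁⟩, hη⟩ := hr
  simp only [add_sub_cancel_left, smul_smul] at hθ hη
  have hz : z = x + (θ * β + a) • e := by
    rw [add_smul, ← add_assoc, hθ, sub_add_cancel]
  have he0 : e ≠ 0 := by
    rintro rfl
    rw [eNorm_zero] at he
    exact zero_ne_one he
  have hη' : (η * β) • e = (θ * β + a + a) • e := by
    rw [hz, add_assoc, ← add_smul] at hη
    exact add_left_cancel hη
  have := smul_left_injective ℝ he0 hη'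
  refine ⟨_, hz, ?_, ?_⟩ <;> nlinarith

theorem eNorm_add_smul_sub_le {x x' e e' : ℝ × ℝ} {t : ℝ} (ht : 0 ≤ t) :
    eNorm (x' + t • e' - (x + t • e)) ≤ eNorm (x' - x) + t * eNorm (e' - e) := by
  have h := eNorm_add_le (x' - x) (t • (e' - e))
  rw [eNorm_smul, abs_of_nonneg ht] at h
  convert h using 2
  module

theorem abs_eInner_perp_sub_le {e₁ e₂ e₁' e₂' : ℝ × ℝ} (he₂ : eNorm e₂ = 1)
    (he₁' : eNorm e₁' = 1) :
    |eInner (perp e₂) e₁| - |eInner (perp e₂') e₁'| ≤ eNorm (e₁' - e₁) + eNorm (e₂' - e₂) := by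
  have hA := abs_eInner_le (perp (e₂' - e₂)) e₁'
  have hB := abs_eInner_le (perp e₂) (e₁' - e₁)
  rw [eNorm_perp, he₁', mul_one] at hA
  rw [eNorm_perp, he₂, one_mul] at hB
  have key : eInner (perp e₂) e₁ - eInner (perp e₂') e₁'
      = -(eInner (perp (e₂' - e₂)) e₁' + eInner (perp e₂) (e₁' - e₁)) := by
    simp only [eInner, perp, Prod.fst_sub, Prod.snd_sub]
    ring
  have h₁ := abs_sub_abs_le_abs_sub (eInner (perp e₂) e₁) (eInner (perp e₂') e₁')
  rw [key, abs_neg] at h₁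
  linarith [abs_add_le (eInner (perp (e₂' - e₂)) e₁') (eInner (perp e₂) (e₁' - e₁))]

/-- Lines through `y₁` and `y₂` in non-parallel unit directions meet, and the distances from `y₁`
and `y₂` to the meeting point are controlled by the distance from `y₁` to `y₂`. -/
theorem exists_add_smul_eq_add_smul {y₁ y₂ u v : ℝ × ℝ} (hu : eNorm u = 1) (hv : eNorm v = 1)
    (hD : eInner (perp v) u ≠ 0) :
    ∃ s t : ℝ, y₁ + s • u = y₂ + t • v ∧
      |s| * |eInner (perp v) u| ≤ eNorm (y₂ - y₁) ∧
      |t| * |eInner (perp v) u| ≤ eNorm (y₂ - y₁) := by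
  refine ⟨eInner (perp v) (y₂ - y₁) / eInner (perp v) u,
    eInner (perp u) (y₂ - y₁) / eInner (perp v) u, ?_, ?_, ?_⟩
  · simp only [eInner, perp] at hD
    ext
    · simp only [eInner, perp, Prod.fst_add, Prod.smul_fst, smul_eq_mul, Prod.fst_sub,
        Prod.snd_sub]
      linear_combination (y₂.1 - y₁.1) * mul_inv_cancel₀ hD
    · simp only [eInner, perp, Prod.snd_add, Prod.smul_snd, smul_eq_mul, Prod.fst_sub,
        Prod.snd_sub]
      linear_combination (y₂.2 - y₁.2) * mul_inv_cancel₀ hD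
  · rw [← abs_mul, div_mul_cancel₀ _ hD]
    simpa only [eNorm_perp, hv, one_mul] using abs_eInner_le (perp v) (y₂ - y₁)
  · rw [← abs_mul, div_mul_cancel₀ _ hD]
    simpa only [eNorm_perp, hu, one_mul] using abs_eInner_le (perp u) (y₂ - y₁)

theorem stmt9 (x₁ x₂ x₃ e₁ e₂ : ℝ × ℝ) (he₁ : eNorm e₁ = 1) (he₂ : eNorm e₂ = 1)
    (α₁ α₂ α : ℝ) (hα₁ : 0 < α₁) (hα₂ : 0 < α₂) (hα : 0 < α)
    (hx₃ : x₃ ∈ segment ℝ x₁ (x₁ + α₁ • e₁) ∩ segment ℝ x₂ (x₂ + α₂ • e₂))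
    (hsub₁ : segment ℝ (x₃ - α • e₁) (x₃ + α • e₁) ⊆ segment ℝ x₁ (x₁ + α₁ • e₁))
    (hsub₂ : segment ℝ (x₃ - α • e₂) (x₃ + α • e₂) ⊆ segment ℝ x₂ (x₂ + α₂ • e₂))
    (x₁' x₂' e₁' e₂' : ℝ × ℝ) (he₁' : eNorm e₁' = 1) (he₂' : eNorm e₂' = 1)
    (hx₁' : eNorm (x₁' - x₁) ≤ α / 16 * |eInner (perp e₂) e₁|)
    (hx₂' : eNorm (x₂' - x₂) ≤ α / 16 * |eInner (perp e₂) e₁|)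
    (he₁'' : eNorm (e₁' - e₁) ≤ α / (8 * (α₁ + α₂)) * |eInner (perp e₂) e₁|)
    (he₂'' : eNorm (e₂' - e₂) ≤ α / (8 * (α₁ + α₂)) * |eInner (perp e₂) e₁|) :
    ∃ x₃' ∈ segment ℝ x₁' (x₁' + α₁ • e₁') ∩ segment ℝ x₂' (x₂' + α₂ • e₂'),
      eNorm (x₃' - x₃) ≤ α := by
  obtain ⟨t₁, hz₁, ht₁, ht₁'⟩ := exists_eq_add_smul_of_segment_subset hα₁ he₁ hsub₁
  obtain ⟨t₂, hz₂, ht₂, ht₂'⟩ := exists_eq_add_smul_of_segment_subset hα₂ he₂ hsub₂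
  rcases eq_or_ne (eInner (perp e₂) e₁) 0 with hD | hD
  · simp only [hD, abs_zero, mul_zero] at hx₁' hx₂' he₁'' he₂''
    rw [sub_eq_zero.1 (eq_zero_of_eNorm_le_zero hx₁'), sub_eq_zero.1 (eq_zero_of_eNorm_le_zero hx₂'),
      sub_eq_zero.1 (eq_zero_of_eNorm_le_zero he₁''), sub_eq_zero.1 (eq_zero_of_eNorm_le_zero he₂'')]
    exact ⟨x₃, hx₃, by rw [sub_self, eNorm_zero]; exact hα.le⟩
  have hDle := abs_eInner_le (perp e₂) e₁
  rw [eNorm_perp, he₁, he₂, one_mul] at hDle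
  have hdiff := abs_eInner_perp_sub_le (e₁ := e₁) (e₂' := e₂') he₂ he₁'
  have hδ := abs_pos.2 hD
  set δ := |eInner (perp e₂) e₁|
  have hc : α / (8 * (α₁ + α₂)) ≤ 1 / 32 := by
    rw [div_le_div_iff₀ (by positivity) (by norm_num)]
    linarith
  have hcα : α / (8 * (α₁ + α₂)) * (α₁ + α₂) = α / 8 := by field_simp
  have hc₀ : 0 ≤ α / (8 * (α₁ + α₂)) := by positivity
  set c := α / (8 * (α₁ + α₂))
  have hcδ : c * δ ≤ 1 / 32 * δ := by gcongr
  have hδ' : 15 / 16 * δ ≤ |eInner (perp e₂') e₁'| := by linarith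
  have hD' : eInner (perp e₂') e₁' ≠ 0 := abs_pos.1 (by linarith)
  have hy₁ := eNorm_add_smul_sub_le (x := x₁) (x' := x₁') (e := e₁) (e' := e₁') (hα.le.trans ht₁)
  have hy₂ := eNorm_add_smul_sub_le (x := x₂) (x' := x₂') (e := e₂) (e' := e₂') (hα.le.trans ht₂)
  rw [← hz₁] at hy₁
  rw [← hz₂] at hy₂
  have hm₁ : t₁ * eNorm (e₁' - e₁) ≤ α₁ * (c * δ) :=
    mul_le_mul (by linarith) he₁'' (eNorm_nonneg _) hα₁.le
  have hm₂ : t₂ * eNorm (e₂' - e₂) ≤ α₂ * (c * δ) :=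
    mul_le_mul (by linarith) he₂'' (eNorm_nonneg _) hα₂.le
  have hm : α₁ * (c * δ) + α₂ * (c * δ) = α / 8 * δ := by rw [← hcα]; ring
  obtain ⟨s, t, hst, hs, ht⟩ := exists_add_smul_eq_add_smul
    (y₁ := x₁' + t₁ • e₁') (y₂ := x₂' + t₂ • e₂') he₁' he₂' hD'
  have hw : eNorm (x₂' + t₂ • e₂' - (x₁' + t₁ • e₁')) ≤ α / 4 * δ := by
    have h := eNorm_add_le (x₂' + t₂ • e₂' - x₃) (-(x₁' + t₁ • e₁' - x₃))
    rw [eNorm_neg, ← sub_eq_add_neg, sub_sub_sub_cancel_right] at h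
    linarith
  have bound : ∀ r : ℝ, |r| * |eInner (perp e₂') e₁'| ≤
      eNorm (x₂' + t₂ • e₂' - (x₁' + t₁ • e₁')) → |r| ≤ α / 2 := by
    intro r hr
    have h : |r| * (15 / 16 * δ) ≤ α / 4 * δ :=
      (mul_le_mul_of_nonneg_left hδ' (abs_nonneg r)).trans (hr.trans hw)
    have h' : |r| * (15 / 16) ≤ α / 4 := le_of_mul_le_mul_right (by linarith) hδ
    linarith
  have hs' := bound s hs
  have ht' := bound t ht
  obtain ⟨hs₀, hs₁⟩ := abs_le.1 hs'
  obtain ⟨ht₀, ht₁⟩ := abs_le.1 ht'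
  refine ⟨x₁' + t₁ • e₁' + s • e₁', ⟨?_, ?_⟩, ?_⟩
  · rw [add_assoc, ← add_smul]
    exact mem_segment_add_smul hα₁ (by linarith) (by linarith)
  · rw [hst, add_assoc, ← add_smul]
    exact mem_segment_add_smul hα₂ (by linarith) (by linarith)
  · have h := eNorm_add_le (x₁' + t₁ • e₁' - x₃) (s • e₁')
    rw [eNorm_smul, he₁', mul_one, sub_add_eq_add_sub] at h
    have hαδ : α * δ ≤ α := mul_le_of_le_one_right hα.le hDle
    have hm₂₀ : 0 ≤ α₂ * (c * δ) := by positivity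
    linarith
end

section
/- Let H be a real Hilbert space, f : H → ℝ Lipschitz with Lip(f) > 0, and ε ∈ (0, Lip(f)/9). Suppose x ∈ H, e a unit vector, s > 0 are such that f'(x,e) exists, is ≥ 0, and |f(x+te) − f(x) − f'(x,e)t| ≤ (ε²/(160 Lip(f)))|t| for |t| ≤ s√(2 Lip(f)/ε). Suppose ξ ∈ (−s/2, s/2) and λ ∈ H satisfy |f(x+λ) − f(x+ξe)| ≥ 240εs, ‖λ − ξe‖ ≤ s√(ε/Lip(f)), and ‖πse+λ‖/|πs+ξ| ≤ 1 + ε/(4 Lip(f)) for π = ±1. Then for any s₁, s₂, λ' ∈ H with max(‖s₁ − se‖, ‖s₂ − se‖) ≤ (ε²/(320 Lip(f)²))s and ‖λ' − λ‖ ≤ εs/(16 Lip(f)), there exist x' ∈ [x−s₁, x+λ'] ∪ [x+λ', x+s₂] and a unit vector e' such that f'(x',e') exists, f'(x',e') ≥ f'(x,e) + ε, and |(f(x'+te) − f(x')) − (f(x+te) − f(x))| ≤ 25√((f'(x',e') − f'(x,e)) Lip(f)) |t| for all t ∈ ℝ. -/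
open Filter

/-- The (two-sided) directional derivative: `f'(x,e) = lim_{t→0} (f(x+te)-f(x))/t = L`. -/
def HasDirDeriv {H : Type*} [NormedAddCommGroup H] [NormedSpace ℝ H]
    (f : H → ℝ) (x e : H) (L : ℝ) : Prop :=
  Tendsto (fun t : ℝ => (f (x + t • e) - f x) / t) (nhdsWithin 0 {0}ᶜ) (nhds L)

/-- The least Lipschitz constant `Lip(f)` of `f`. -/
noncomputable def lipConst {H : Type*} [NormedAddCommGroup H] (f : H → ℝ) : ℝ :=
  sInf {K : ℝ | 0 ≤ K ∧ ∀ x y, |f x - f y| ≤ K * ‖x - y‖}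

section
open MeasureTheory Set

theorem LipschitzWith.integral_deriv_eq_sub {h : ℝ → ℝ} {K : NNReal} (hK : LipschitzWith K h)
    (a b : ℝ) : ∫ x in a..b, deriv h x = h b - h a :=
  hK.lipschitzOnWith.absolutelyContinuousOnInterval.integral_deriv_eq_sub

theorem LipschitzWith.integrableOn_deriv {h : ℝ → ℝ} {K : NNReal} (hK : LipschitzWith K h)
    (a b : ℝ) : IntegrableOn (deriv h) (Icc a b) := by
  refine Measure.integrableOn_of_bounded (M := K) (by simp)
    (measurable_deriv h).aestronglyMeasurable (ae_of_all _ fun x => norm_deriv_le_of_lipschitz hK)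

/-- Maximal-type inequality for the variation of a Lipschitz function on an interval. -/
theorem LipschitzWith.volume_steep_le {h : ℝ → ℝ} {K : NNReal} (hK : LipschitzWith K h)
    (a b : ℝ) {l : ℝ} (hl : 0 < l) :
    volume {τ | τ ∈ Icc a b ∧ ∃ t ∈ Icc a b, l * |t - τ| < |h t - h τ|} ≤
      ENNReal.ofReal (4 / l) * ∫⁻ x in Icc a b, ‖deriv h x‖ₑ := by
  set S := {τ | τ ∈ Icc a b ∧ ∃ t ∈ Icc a b, l * |t - τ| < |h t - h τ|} with hS
  have hS' : ∀ τ : ℝ, ∃ t, τ ∈ S → t ∈ Icc a b ∧ l * |t - τ| < |h t - h τ| := by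
    intro τ
    by_cases hτ : τ ∈ S
    · obtain ⟨t, ht⟩ := hτ.2
      exact ⟨t, fun _ => ht⟩
    · exact ⟨0, fun h => absurd h hτ⟩
  choose g hg using hS'
  have hpos : ∀ τ ∈ S, 0 < |g τ - τ| := by
    intro τ hτ
    rcases (abs_nonneg (g τ - τ)).eq_or_lt with h0 | h0
    · have h1 := (hg τ hτ).2
      have h2 : g τ = τ := by linarith [abs_eq_zero.1 h0.symm]
      simp [h2] at h1
    · exact h0
  have hball : ∀ τ, Metric.closedBall ((τ + g τ) / 2) (|g τ - τ| / 2) = uIcc τ (g τ) := by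
    intro τ
    rw [Real.closedBall_eq_Icc]
    rcases le_total τ (g τ) with h1 | h1
    · rw [uIcc_of_le h1, abs_of_nonneg (by linarith)]; congr 1 <;> ring
    · rw [uIcc_of_ge h1, abs_of_nonpos (by linarith)]; congr 1 <;> ring
  obtain ⟨u, huS, hud, hcov⟩ :=
    Vitali.exists_disjoint_subfamily_covering_enlargement_closedBall S
      (fun τ => (τ + g τ) / 2) (fun τ => |g τ - τ| / 2) ((b - a) / 2)
      (fun τ hτ => by
        have h1 := (hg τ hτ).1
        have h2 := hτ.1
        have : |g τ - τ| ≤ b - a := by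
          rw [abs_le]; constructor <;> linarith [h1.1, h1.2, h2.1, h2.2]
        linarith) 4 (by norm_num)
  simp only [hball] at hud hcov
  have hcount : u.Countable := by
    refine hud.countable_of_nonempty_interior fun τ hτ => ?_
    rw [← hball]
    refine ⟨(τ + g τ) / 2, ?_⟩
    rw [interior_closedBall _ (by have := hpos τ (huS hτ); positivity)]
    exact Metric.mem_ball_self (by have := hpos τ (huS hτ); positivity)
  have hsub : S ⊆ ⋃ τ ∈ u, Metric.closedBall ((τ + g τ) / 2) (4 * (|g τ - τ| / 2)) := by
    intro τ hτ
    obtain ⟨τ', hτ', hh⟩ := hcov τ hτ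
    exact mem_biUnion hτ' (hh left_mem_uIcc)
  have hincl : ∀ τ ∈ u, uIcc τ (g τ) ⊆ Icc a b := fun τ hτ =>
    ordConnected_Icc.uIcc_subset (huS hτ).1 (hg τ (huS hτ)).1
  have hone : ∀ τ ∈ u, volume (Metric.closedBall ((τ + g τ) / 2) (4 * (|g τ - τ| / 2))) ≤
      ENNReal.ofReal (4 / l) * ∫⁻ x in uIcc τ (g τ), ‖deriv h x‖ₑ := by
    intro τ hτ
    rw [Real.volume_closedBall]
    have h1 : ‖h (g τ) - h τ‖ₑ ≤ ∫⁻ x in uIcc τ (g τ), ‖deriv h x‖ₑ := by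
      rw [← hK.integral_deriv_eq_sub]
      have h2 : ‖∫ x in τ..g τ, deriv h x‖ₑ = ‖∫ x in uIoc τ (g τ), deriv h x‖ₑ := by
        rw [← ofReal_norm, ← ofReal_norm, intervalIntegral.norm_intervalIntegral_eq]
      rw [h2]
      exact (enorm_integral_le_lintegral_enorm _).trans (lintegral_mono_set uIoc_subset_uIcc)
    refine le_trans ?_ (mul_le_mul_right h1 _)
    rw [Real.enorm_eq_ofReal_abs, ← ENNReal.ofReal_mul (by positivity)]
    apply ENNReal.ofReal_le_ofReal
    have h3 := (hg τ (huS hτ)).2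
    rw [div_mul_eq_mul_div, le_div_iff₀ hl]
    linarith
  calc volume S ≤ volume (⋃ τ ∈ u, Metric.closedBall ((τ + g τ) / 2) (4 * (|g τ - τ| / 2))) :=
        measure_mono hsub
    _ ≤ ∑' τ : u, volume (Metric.closedBall (((τ : ℝ) + g τ) / 2) (4 * (|g τ - τ| / 2))) :=
        measure_biUnion_le _ hcount _
    _ ≤ ∑' τ : u, ENNReal.ofReal (4 / l) * ∫⁻ x in uIcc (τ : ℝ) (g τ), ‖deriv h x‖ₑ :=
        ENNReal.tsum_le_tsum fun τ => hone τ τ.2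
    _ = ENNReal.ofReal (4 / l) * ∫⁻ x in ⋃ τ ∈ u, uIcc τ (g τ), ‖deriv h x‖ₑ := by
        rw [ENNReal.tsum_mul_left, lintegral_biUnion hcount (fun _ _ => measurableSet_uIcc) hud]
    _ ≤ _ := mul_le_mul_right (lintegral_mono_set (iUnion₂_subset hincl)) _

theorem LipschitzWith.exists_deriv_controls_slopes {h : ℝ → ℝ} {K : NNReal}
    (hK : LipschitzWith K h) {a b ξ c w P D : ℝ} (hab : a < b) (hc : 0 < c) (hw : 0 ≤ w)
    (hD : 0 < D) (hP0 : 0 ≤ P)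
    (hP : ∀ τ ∈ Icc a b, τ ≠ ξ → DifferentiableAt ℝ h τ → deriv h τ ≤ P)
    (hbig : c * (b - a) + 2 * w * P + 8 * √P / D * ∫ x in Icc a b, |deriv h x| <
      ∫ x in Icc a b, max (deriv h x) 0) :
    ∃ τ ∈ Icc (a + w) (b - w), τ ≠ ξ ∧ DifferentiableAt ℝ h τ ∧ c < deriv h τ ∧
      ∀ t ∈ Icc a b, |h t - h τ| ≤ D * √(deriv h τ) * |t - τ| := by
  by_contra hcon
  push Not at hcon
  refine absurd hbig (not_lt.2 ?_)
  set V := ∫ x in Icc a b, |deriv h x| with hV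
  have hV0 : 0 ≤ V := by positivity
  have hVl : ∫⁻ x in Icc a b, ‖deriv h x‖ₑ = ENNReal.ofReal V := by
    rw [hV, ofReal_integral_eq_lintegral_ofReal (hK.integrableOn_deriv a b).abs
      (ae_of_all _ fun _ => abs_nonneg _)]
    simp [Real.enorm_eq_ofReal_abs]
  have hint : IntegrableOn (fun x => max (deriv h x) 0) (Icc a b) :=
    (hK.integrableOn_deriv a b).pos_part
  have hnn : ∀ x, 0 ≤ max (deriv h x) 0 := fun _ => le_max_right _ _
  set G : ℝ → ℝ := fun p => (Ioc 0 c).indicator (fun _ => b - a) p + 2 * w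
    + 4 * V / D * p ^ (-(1 / 2) : ℝ) with hG
  have hi1 : IntegrableOn ((Ioc 0 c).indicator (fun _ => b - a)) (Ioc 0 P) :=
    (integrableOn_const (by simp)).indicator measurableSet_Ioc
  have hi2 : IntegrableOn (fun p : ℝ => 4 * V / D * p ^ (-(1 / 2) : ℝ)) (Ioc 0 P) :=
    Integrable.const_mul ((intervalIntegrable_iff_integrableOn_Ioc_of_le hP0).1
        (intervalIntegral.intervalIntegrable_rpow' (by norm_num))) _
  have hGint : IntegrableOn G (Ioc 0 P) :=
    (hi1.add (integrable_const _)).add hi2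
  have hGval : ∫ p in Ioc 0 P, G p ≤ c * (b - a) + 2 * w * P + 8 * √P / D * V := by
    have e1 : ∫ p in Ioc 0 P, (Ioc 0 c).indicator (fun _ => b - a) p ≤ c * (b - a) := by
      rw [setIntegral_indicator measurableSet_Ioc, setIntegral_const, smul_eq_mul]
      refine mul_le_mul_of_nonneg_right ?_ (by linarith)
      exact (measureReal_mono inter_subset_right (by simp)).trans_eq (by simp [hc.le])
    have e2 : ∫ p in Ioc 0 P, 4 * V / D * p ^ (-(1 / 2) : ℝ) = 8 * √P / D * V := by
      rw [integral_const_mul, ← intervalIntegral.integral_of_le hP0,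
        integral_rpow (Or.inl (by norm_num))]
      norm_num [← Real.sqrt_eq_rpow]
      ring
    have e3 : ∫ p in Ioc 0 P, G p = (∫ p in Ioc 0 P, (Ioc 0 c).indicator (fun _ => b - a) p)
        + 2 * w * P + ∫ p in Ioc 0 P, 4 * V / D * p ^ (-(1 / 2) : ℝ) := by
      have e4 := integral_add (hi1.add (integrable_const (2 * w))) hi2
      have e5 := integral_add hi1 (integrable_const (2 * w))
      simp only [Pi.add_apply] at e4
      rw [e5, setIntegral_const, Real.volume_real_Ioc_of_le hP0, sub_zero, smul_eq_mul,
        mul_comm P] at e4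
      exact e4
    linarith
  have hG0 : ∀ p ∈ Ioc 0 P, 0 ≤ G p := by
    intro p hp
    have : 0 ≤ (Ioc 0 c).indicator (fun _ => b - a) p :=
      indicator_nonneg (fun _ _ => by linarith) _
    have := Real.rpow_nonneg hp.1.le (-(1 / 2) : ℝ)
    simp only [hG]
    positivity
  have hnull : ∀ᵐ τ, DifferentiableAt ℝ h τ ∧ τ ≠ ξ :=
    hK.ae_differentiableAt_real.and (Measure.ae_ne volume ξ)
  have key : ∀ p : ℝ, 0 < p → (volume.restrict (Icc a b)) {τ | p < max (deriv h τ) 0} ≤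
      (Ioc 0 P).indicator (fun p => ENNReal.ofReal (G p)) p := by
    intro p hp
    rw [Measure.restrict_apply' measurableSet_Icc]
    by_cases hpP : p ≤ P
    swap
    · refine le_trans (le_of_eq ?_) zero_le
      refine measure_mono_null_ae ?_ measure_empty
      filter_upwards [hnull] with τ hτ hmem
      have := hP τ hmem.2 hτ.2 hτ.1
      have h2 : p < max (deriv h τ) 0 := hmem.1
      rcases lt_max_iff.1 h2 with h3 | h3 <;> linarith
    rw [indicator_of_mem (show p ∈ Ioc 0 P from ⟨hp, hpP⟩)]
    have hr : 0 ≤ p ^ (-(1 / 2) : ℝ) := Real.rpow_nonneg hp.le _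
    by_cases hpc : p ≤ c
    · refine (measure_mono inter_subset_right).trans ?_
      rw [Real.volume_Icc]
      apply ENNReal.ofReal_le_ofReal
      simp only [hG]
      rw [indicator_of_mem (show p ∈ Ioc 0 c from ⟨hp, hpc⟩)]
      have : 0 ≤ 4 * V / D * p ^ (-(1 / 2) : ℝ) := by positivity
      linarith
    rw [not_le] at hpc
    have hl : 0 < D * √p := by positivity
    have hsteep := hK.volume_steep_le a b hl
    have hGp : ENNReal.ofReal (G p) = ENNReal.ofReal w + ENNReal.ofReal w +
        ENNReal.ofReal (4 / (D * √p)) * ENNReal.ofReal V := by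
      rw [← ENNReal.ofReal_add hw hw, ← ENNReal.ofReal_mul (by positivity),
        ← ENNReal.ofReal_add (by positivity) (by positivity)]
      congr 1
      simp only [hG]
      rw [indicator_of_notMem (fun hh : p ∈ Ioc 0 c => by linarith [hh.2]), Real.rpow_neg hp.le,
        ← Real.sqrt_eq_rpow]
      field_simp
      ring
    rw [hGp, ← hVl]
    refine le_trans ?_ (add_le_add_right hsteep _)
    have hv1 : ENNReal.ofReal w = volume (Icc a (a + w)) := by simp
    have hv2 : ENNReal.ofReal w = volume (Icc (b - w) b) := by simp
    nth_rewrite 1 [hv1]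
    rw [hv2]
    refine le_trans ?_ (add_le_add_left (measure_union_le _ _) _)
    refine le_trans ?_ (measure_union_le _ _)
    refine measure_mono_ae ?_
    filter_upwards [hnull] with τ hτ hmem
    have h2 : p < max (deriv h τ) 0 := hmem.1
    have h3 : p < deriv h τ := by
      rcases lt_max_iff.1 h2 with h3 | h3 <;> linarith
    have h4 := hmem.2
    by_cases h5 : a + w ≤ τ
    swap
    · exact Or.inl (Or.inl ⟨h4.1, by linarith⟩)
    by_cases h6 : τ ≤ b - w
    swap
    · exact Or.inl (Or.inr ⟨by linarith, h4.2⟩)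
    obtain ⟨t, ht, ht'⟩ := hcon τ ⟨h5, h6⟩ hτ.2 hτ.1 (by linarith)
    refine Or.inr ⟨h4, t, ht, lt_of_le_of_lt ?_ ht'⟩
    gcongr
  have : ENNReal.ofReal (∫ x in Icc a b, max (deriv h x) 0) ≤
      ENNReal.ofReal (∫ p in Ioc 0 P, G p) := by
    rw [ofReal_integral_eq_lintegral_ofReal hint (ae_of_all _ hnn),
      lintegral_eq_lintegral_meas_lt _ (ae_of_all _ hnn)
        hint.aestronglyMeasurable.aemeasurable,
      ofReal_integral_eq_lintegral_ofReal hGint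
        ((ae_restrict_iff' measurableSet_Ioc).2 (ae_of_all _ hG0)),
      ← lintegral_indicator measurableSet_Ioc]
    refine (setLIntegral_mono' measurableSet_Ioi fun p hp => key p hp).trans ?_
    exact setLIntegral_le_lintegral _ _
  refine le_trans ?_ hGval
  exact (ENNReal.ofReal_le_ofReal_iff
    (setIntegral_nonneg measurableSet_Ioc hG0)).1 this

/-- A Lipschitz function with a large bump between nearly equal endpoint values has a point of
differentiability at which the derivative is large and controls all slopes. -/
theorem LipschitzWith.exists_deriv_controls_slopes_of_bump {h : ℝ → ℝ} {K : NNReal}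
    (hK : LipschitzWith K h) {a b ξ c w P D m : ℝ} (hξ : ξ ∈ Ioo a b) (hc : 0 < c) (hw : 0 ≤ w)
    (hD : 0 < D) (hP0 : 0 ≤ P)
    (hP : ∀ τ ∈ Icc a b, τ ≠ ξ → DifferentiableAt ℝ h τ → deriv h τ ≤ P)
    (ha : |h a| ≤ m) (hb : |h b| ≤ m) (hPD : 16 * √P ≤ D)
    (hbig : c * (b - a) + 2 * w * P + 16 * √P / D * m < (1 - 16 * √P / D) * (|h ξ| - m)) :
    ∃ τ ∈ Icc (a + w) (b - w), τ ≠ ξ ∧ DifferentiableAt ℝ h τ ∧ c < deriv h τ ∧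
      ∀ t ∈ Icc a b, |h t - h τ| ≤ D * √(deriv h τ) * |t - τ| := by
  have hab : a < b := hξ.1.trans hξ.2
  refine hK.exists_deriv_controls_slopes hab hc hw hD hP0 hP ?_
  have hi := hK.integrableOn_deriv a b
  have hint : IntegrableOn (fun x => max (deriv h x) 0) (Icc a b) := hi.pos_part
  set X := ∫ x in Icc a b, max (deriv h x) 0 with hX
  have hV : ∫ x in Icc a b, |deriv h x| = 2 * X - (h b - h a) := by
    rw [← hK.integral_deriv_eq_sub, intervalIntegral.integral_of_le hab.le,
      ← integral_Icc_eq_integral_Ioc, hX, ← integral_const_mul,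
      ← integral_sub (hint.const_mul 2) hi]
    refine integral_congr_ae (ae_of_all _ fun x => ?_)
    simp only
    rcases le_total 0 (deriv h x) with h0 | h0
    · rw [abs_of_nonneg h0, max_eq_left h0]; ring
    · rw [abs_of_nonpos h0, max_eq_right h0]; ring
  have hmono : ∀ y z, y ∈ Icc a b → z ∈ Icc a b → y ≤ z → h z - h y ≤ X := by
    intro y z hy hz hyz
    have hsub : Icc y z ⊆ Icc a b := Icc_subset_Icc hy.1 hz.2
    rw [← hK.integral_deriv_eq_sub, intervalIntegral.integral_of_le hyz,
      ← integral_Icc_eq_integral_Ioc]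
    refine (setIntegral_mono (hi.mono_set hsub) (hint.mono_set hsub)
      fun x => le_max_left _ _).trans ?_
    exact setIntegral_mono_set hint (ae_of_all _ fun x => le_max_right _ _)
      hsub.eventuallyLE
  have hXξ : |h ξ| - m ≤ X := by
    rw [abs_le] at ha hb
    rcases le_total 0 (h ξ) with h0 | h0
    · have := hmono a ξ (left_mem_Icc.2 hab.le) (Ioo_subset_Icc_self hξ) hξ.1.le
      rw [abs_of_nonneg h0]; linarith
    · have := hmono ξ b (Ioo_subset_Icc_self hξ) (right_mem_Icc.2 hab.le) hξ.2.le
      rw [abs_of_nonpos h0]; linarith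
  rw [hV]
  have hq : 16 * √P / D ≤ 1 := (div_le_one hD).2 hPD
  have hq0 : 0 ≤ 8 * √P / D := by positivity
  have h1 : (1 - 16 * √P / D) * (|h ξ| - m) ≤ (1 - 16 * √P / D) * X :=
    mul_le_mul_of_nonneg_left hXξ (by linarith)
  have h2 : -(h b - h a) ≤ 2 * m := by
    rw [abs_le] at ha hb
    linarith
  have h3 := mul_le_mul_of_nonneg_left h2 hq0
  have h4 : 16 * √P / D = 2 * (8 * √P / D) := by ring
  rw [h4] at h1 hbig
  nlinarith

end

section
variable {H : Type*} [NormedAddCommGroup H]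

theorem abs_sub_le_lipConst_mul {f : H → ℝ} (hf : ∃ K : NNReal, LipschitzWith K f) (x y : H) :
    |f x - f y| ≤ lipConst f * ‖x - y‖ := by
  obtain ⟨K, hK⟩ := hf
  rcases (norm_nonneg (x - y)).eq_or_lt with h0 | h0
  · have : x = y := sub_eq_zero.1 (norm_eq_zero.1 h0.symm)
    simp [this]
  rw [← div_le_iff₀ h0]
  refine le_csInf ⟨K, K.2, fun a b => ?_⟩ fun M hM => ?_
  · simpa [dist_eq_norm] using hK.dist_le_mul a b
  · rw [div_le_iff₀ h0]
    exact hM.2 x y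

variable [NormedSpace ℝ H]

theorem HasDirDeriv.le_of_lipschitz {f : H → ℝ} {L : ℝ} (hL : ∀ x y, |f x - f y| ≤ L * ‖x - y‖)
    {x e : H} {d : ℝ} (h : HasDirDeriv f x e d) : d ≤ L * ‖e‖ := by
  refine le_of_tendsto h ?_
  filter_upwards [self_mem_nhdsWithin] with t ht
  have ht' : 0 < |t| := abs_pos.2 ht
  refine (le_abs_self _).trans ?_
  rw [abs_div, div_le_iff₀ ht']
  have := hL (x + t • e) x
  rw [add_sub_cancel_left, norm_smul, Real.norm_eq_abs] at this
  linarith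

theorem HasDerivAt.hasDirDeriv_normalized {f : H → ℝ} {z v : H} {p : ℝ}
    (h : HasDerivAt (fun u : ℝ => f (z + u • v)) p 0) :
    HasDirDeriv f z (‖v‖⁻¹ • v) (p * ‖v‖⁻¹) := by
  have h' : HasDerivAt (fun u : ℝ => f (z + u • v)) p (‖v‖⁻¹ * 0) := by simpa using h
  have h1 : HasDerivAt (fun u : ℝ => ‖v‖⁻¹ * u) ‖v‖⁻¹ 0 := by
    simpa using (hasDerivAt_id (0 : ℝ)).const_mul ‖v‖⁻¹
  have h2 := h'.comp 0 h1
  rw [hasDerivAt_iff_tendsto_slope_zero] at h2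
  refine h2.congr fun t => ?_
  simp [smul_smul, mul_comm, div_eq_inv_mul]

/-- The broken line through `y` at time `ξ` with velocity `v₁` before and `v₂` after. -/
noncomputable def brokenLine (y v₁ v₂ : H) (ξ t : ℝ) : H :=
  y + (min (t - ξ) 0 • v₁ + max (t - ξ) 0 • v₂)

theorem brokenLine_of_le (y v₁ v₂ : H) {ξ t : ℝ} (h : t ≤ ξ) :
    brokenLine y v₁ v₂ ξ t = y + (t - ξ) • v₁ := by
  simp [brokenLine, h]

theorem brokenLine_of_ge (y v₁ v₂ : H) {ξ t : ℝ} (h : ξ ≤ t) :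
    brokenLine y v₁ v₂ ξ t = y + (t - ξ) • v₂ := by
  simp [brokenLine, h]

theorem norm_brokenLine_sub_le (y : H) {v₁ v₂ e : H} {ξ β : ℝ} (h₁ : ‖v₁ - e‖ ≤ β)
    (h₂ : ‖v₂ - e‖ ≤ β) (t u : ℝ) :
    ‖brokenLine y v₁ v₂ ξ t - brokenLine y v₁ v₂ ξ u - (t - u) • e‖ ≤ β * |t - u| := by
  have h1 : ∀ t : ℝ, min (t - ξ) 0 + max (t - ξ) 0 = t - ξ := fun t => by
    rw [min_add_max, add_zero]
  have h3 : brokenLine y v₁ v₂ ξ t - brokenLine y v₁ v₂ ξ u - (t - u) • e =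
      (min (t - ξ) 0 - min (u - ξ) 0) • (v₁ - e) + (max (t - ξ) 0 - max (u - ξ) 0) • (v₂ - e) := by
    have : t - u = (min (t - ξ) 0 + max (t - ξ) 0) - (min (u - ξ) 0 + max (u - ξ) 0) := by
      rw [h1, h1]; ring
    rw [this]
    simp only [brokenLine]
    module
  have h4 : |min (t - ξ) 0 - min (u - ξ) 0| + |max (t - ξ) 0 - max (u - ξ) 0| = |t - u| := by
    rcases le_total t ξ with a | a <;> rcases le_total u ξ with b | b <;>
      rcases le_total t u with c | c <;> simp only [a, b, sub_nonneg, sub_nonpos, min_eq_left,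
        min_eq_right, max_eq_left, max_eq_right] <;>
      (try rw [abs_of_nonneg (by linarith : 0 ≤ t - u)]) <;>
      (try rw [abs_of_nonpos (by linarith : t - u ≤ 0)]) <;>
      first
      | rw [abs_of_nonneg (by linarith), abs_of_nonneg (by linarith)]; linarith
      | rw [abs_of_nonpos (by linarith), abs_of_nonpos (by linarith)]; linarith
  rw [h3, ← h4, mul_add]
  refine (norm_add_le _ _).trans ?_
  rw [norm_smul, norm_smul, Real.norm_eq_abs, Real.norm_eq_abs, mul_comm β, mul_comm β]
  gcongr

theorem brokenLine_eventuallyEq (y v₁ v₂ : H) {ξ τ : ℝ} (h : τ ≠ ξ) :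
    ∃ v, (v = v₁ ∨ v = v₂) ∧ ∀ᶠ t in nhds τ,
      brokenLine y v₁ v₂ ξ t = brokenLine y v₁ v₂ ξ τ + (t - τ) • v := by
  rcases lt_or_gt_of_ne h with h | h
  · refine ⟨v₁, Or.inl rfl, ?_⟩
    filter_upwards [gt_mem_nhds h] with t ht
    rw [brokenLine_of_le _ _ _ ht.le, brokenLine_of_le _ _ _ h.le]
    module
  · refine ⟨v₂, Or.inr rfl, ?_⟩
    filter_upwards [lt_mem_nhds h] with t ht
    rw [brokenLine_of_ge _ _ _ ht.le, brokenLine_of_ge _ _ _ h.le]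
    module

theorem brokenLine_mem_segment (y v₁ v₂ : H) {ξ a b τ : ℝ} (hξ : ξ ∈ Set.Ioo a b)
    (hτ : τ ∈ Set.Icc a b) :
    brokenLine y v₁ v₂ ξ τ ∈ segment ℝ (brokenLine y v₁ v₂ ξ a) y ∪
      segment ℝ y (brokenLine y v₁ v₂ ξ b) := by
  rcases le_total τ ξ with h | h
  · left
    rw [brokenLine_of_le _ _ _ h, brokenLine_of_le _ _ _ hξ.1.le, segment_symm, segment_eq_image']
    have : 0 < ξ - a := sub_pos.2 hξ.1
    refine ⟨(ξ - τ) / (ξ - a), ⟨div_nonneg (by linarith) this.le,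
      (div_le_one this).2 (by linarith [hτ.1])⟩, ?_⟩
    simp only [add_sub_cancel_left, smul_smul]
    congr 2
    field_simp
    ring
  · right
    rw [brokenLine_of_ge _ _ _ h, brokenLine_of_ge _ _ _ hξ.2.le, segment_eq_image']
    have : 0 < b - ξ := sub_pos.2 hξ.2
    refine ⟨(τ - ξ) / (b - ξ), ⟨div_nonneg (by linarith) this.le,
      (div_le_one this).2 (by linarith [hτ.2])⟩, ?_⟩
    simp only [add_sub_cancel_left, smul_smul]
    congr 2
    field_simp

end

section
variable {H : Type*} [NormedAddCommGroup H] [NormedSpace ℝ H]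

theorem norm_inv_smul_sub_le {a e : H} {p β : ℝ} (hp : 0 < p) (h : ‖a - p • e‖ ≤ p * β) :
    ‖p⁻¹ • a - e‖ ≤ β := by
  have h1 : p⁻¹ • a - e = p⁻¹ • (a - p • e) := by
    rw [smul_sub, smul_smul, inv_mul_cancel₀ hp.ne', one_smul]
  rwa [h1, norm_smul, Real.norm_of_nonneg (by positivity), inv_mul_le_iff₀ hp]

theorem abs_endpoint_sub_le {f : H → ℝ} {L r : ℝ} (hL : 0 < L)
    (hf : ∀ x y, |f x - f y| ≤ L * ‖x - y‖) (hr : 0 < r)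
    {x z e : H} {s fd σ : ℝ} (hs : 0 < s) (hσ : |σ| = s)
    (happrox : |f (x + σ • e) - f x - fd * σ| ≤ r ^ 4 * L / 160 * |σ|)
    (hz : ‖z - (x + σ • e)‖ ≤ r ^ 4 * s / 320) :
    |f z - f x - fd * σ| ≤ 1 / 100 * (r ^ 4 * L * s) := by
  have h1 : |f z - f (x + σ • e)| ≤ L * (r ^ 4 * s / 320) :=
    (hf _ _).trans (by gcongr)
  have h2 : f z - f x - fd * σ = (f z - f (x + σ • e)) + (f (x + σ • e) - f x - fd * σ) := by ring
  rw [h2]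
  refine (abs_add_le _ _).trans ?_
  rw [hσ] at happrox
  have : 0 ≤ r ^ 4 * L * s := by positivity
  linarith

theorem abs_increment_sub_le_of_exterior {f : H → ℝ} {L r Q : ℝ} (hL : 0 < L)
    (hf : ∀ x y, |f x - f y| ≤ L * ‖x - y‖) (hr : 0 < r) (hr1 : r ≤ 1 / 240)
    {x z e : H} {s fd τ σ t : ℝ} (hs : 0 < s)
    (happrox : ∀ t : ℝ, |t| ≤ s * (1.4 / r) →
      |f (x + t • e) - f x - fd * t| ≤ r ^ 4 * L / 160 * |t|)
    (hτ : |τ| ≤ s) (htr : |t| ≤ s / r) (hσt : |σ - τ| ≤ |t|) (ht : 10 * r ^ 2 * s ≤ |t|)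
    {zσ : H} (hz : ‖zσ - z - (σ - τ) • e‖ ≤ 2.01 * r * |σ - τ|)
    (hzσ : ‖zσ - (x + σ • e)‖ ≤ r ^ 4 * s / 320)
    (hhσ : |f zσ - f x - fd * σ| ≤ 1 / 100 * (r ^ 4 * L * s))
    (hslope : |f zσ - f z - fd * (σ - τ)| ≤ 21 * Q * |σ - τ|) (hQr : 2 * (r * L) ≤ Q) :
    |(f (z + t • e) - f z) - (f (x + t • e) - f x)| ≤ 25 * Q * |t| := by
  have ht0 := abs_nonneg t
  have hrL : 0 < r * L := by positivity
  have hsr : s ≤ s / r * (1 / 240) := by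
    rw [div_mul_eq_mul_div, le_div_iff₀ hr]; nlinarith
  have hA0 : 0 < s / r := by positivity
  have hA : s * (1.4 / r) = 1.4 * (s / r) := by ring
  have hτt : |τ + t| ≤ s + |t| := (abs_add_le _ _).trans (by linarith)
  have h1 := happrox t (by rw [hA]; linarith)
  have h2 := happrox (τ + t) (by rw [hA]; linarith)
  have hrL' : r ^ 2 * L ≤ 1 / 240 * (r * L) := by nlinarith
  have hst : r ^ 4 * L * s ≤ 1 / 10 * (r ^ 2 * L) * |t| := by
    have := mul_le_mul_of_nonneg_left ht (by positivity : 0 ≤ r ^ 2 * L)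
    linarith
  have hst' : r ^ 4 * L * s ≤ 1 / 2400 * (r * L) * |t| := by
    have := mul_le_mul_of_nonneg_right hrL' ht0
    linarith
  have hr4 : r ^ 4 * L * |t| ≤ 1 / 240 * (r * L) * |t| := by
    have h3 : r ^ 4 * L ≤ r ^ 2 * L := by
      have : r ^ 4 ≤ r ^ 2 := pow_le_pow_of_le_one hr.le (by linarith) (by norm_num)
      gcongr
    have := mul_le_mul_of_nonneg_right (h3.trans hrL') ht0
    linarith
  have h3 : |f (z + t • e) - f (x + (τ + t) • e)| ≤
      L * (2.01 * r * |t|) + r ^ 4 * L * s / 320 := by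
    refine (hf _ _).trans ?_
    have h4 : z + t • e - (x + (τ + t) • e) =
        (zσ - (x + σ • e)) - (zσ - z - (σ - τ) • e) := by module
    have h5 : ‖z + t • e - (x + (τ + t) • e)‖ ≤ r ^ 4 * s / 320 + 2.01 * r * |t| := by
      rw [h4]
      refine (norm_sub_le _ _).trans (add_le_add hzσ (hz.trans ?_))
      gcongr
    have := mul_le_mul_of_nonneg_left h5 hL.le
    linarith
  have h4 : |f zσ - f z - fd * (σ - τ)| ≤ 21 * Q * |t| :=
    hslope.trans (by have : 0 ≤ Q := by linarith
                     gcongr)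
  have h5 : r ^ 4 * L / 160 * |τ + t| ≤ r ^ 4 * L / 160 * (s + |t|) := by gcongr
  have hQt := mul_le_mul_of_nonneg_right hQr ht0
  have hid : (f (z + t • e) - f z) - (f (x + t • e) - f x) =
      (f (z + t • e) - f (x + (τ + t) • e)) + (f (x + (τ + t) • e) - f x - fd * (τ + t)) +
      (f zσ - f z - fd * (σ - τ)) - (f zσ - f x - fd * σ) - (f (x + t • e) - f x - fd * t) := by
    ring
  rw [hid]
  rw [abs_le] at *
  constructor <;> linarith

theorem abs_increment_sub_le {f : H → ℝ} {L r Q : ℝ} (hL : 0 < L)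
    (hf : ∀ x y, |f x - f y| ≤ L * ‖x - y‖) (hr : 0 < r) (hr1 : r ≤ 1 / 240)
    {x e : H} (he : ‖e‖ = 1) {s fd : ℝ} (hs : 0 < s)
    (happrox : ∀ t : ℝ, |t| ≤ s * (1.4 / r) →
      |f (x + t • e) - f x - fd * t| ≤ r ^ 4 * L / 160 * |t|)
    {γ : ℝ → H} (hγe : ∀ t u, ‖γ t - γ u - (t - u) • e‖ ≤ 2.01 * r * |t - u|)
    (hγa : ‖γ (-s) - (x + (-s) • e)‖ ≤ r ^ 4 * s / 320)
    (hγb : ‖γ s - (x + s • e)‖ ≤ r ^ 4 * s / 320)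
    (hha : |f (γ (-s)) - f x - fd * -s| ≤ 1 / 100 * (r ^ 4 * L * s))
    (hhb : |f (γ s) - f x - fd * s| ≤ 1 / 100 * (r ^ 4 * L * s))
    {τ : ℝ} (hτ1 : -s + 10 * r ^ 2 * s ≤ τ) (hτ2 : τ ≤ s - 10 * r ^ 2 * s)
    (hslope : ∀ u ∈ Set.Icc (-s) s, |f (γ u) - f (γ τ) - fd * (u - τ)| ≤ 21 * Q * |u - τ|)
    (hQr : 2 * (r * L) ≤ Q) (t : ℝ) :
    |(f (γ τ + t • e) - f (γ τ)) - (f (x + t • e) - f x)| ≤ 25 * Q * |t| := by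
  have ht0 := abs_nonneg t
  have hrL : 0 < r * L := by positivity
  have hw : 0 < 10 * r ^ 2 * s := by positivity
  have hτs : |τ| ≤ s := abs_le.2 ⟨by linarith, by linarith⟩
  have hQt := mul_le_mul_of_nonneg_right hQr ht0
  have hA0 : 0 < s / r := by positivity
  rcases le_or_gt |t| (s / r) with htr | htr
  swap
  · rw [div_lt_iff₀ hr] at htr
    have h1 : ‖γ τ - x‖ ≤ 1.1 * s := by
      have h2 : γ τ - x = (γ s - (x + s • e)) - (γ s - γ τ - (s - τ) • e) + τ • e := by module
      have h3 := hγe s τ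
      rw [abs_of_nonneg (by linarith : 0 ≤ s - τ)] at h3
      have h4 : 2.01 * r * (s - τ) ≤ 2.01 * (1 / 240) * (2 * s) := by
        gcongr <;> linarith
      have h5 : r ^ 4 * s ≤ 1 * s := by
        gcongr
        exact pow_le_one₀ hr.le (by linarith)
      have h6 : ‖τ • e‖ ≤ s := by rwa [norm_smul, he, mul_one]
      rw [h2]
      refine (norm_add_le _ _).trans ((add_le_add (norm_sub_le _ _) le_rfl).trans ?_)
      linarith
    have h2 := hf (γ τ + t • e) (x + t • e)
    rw [add_sub_add_right_eq_sub] at h2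
    have h3 := hf (γ τ) x
    have h4 : L * ‖γ τ - x‖ ≤ 1.1 * (r * L * |t|) := by
      calc L * ‖γ τ - x‖ ≤ L * (1.1 * (|t| * r)) := by gcongr; linarith
        _ = _ := by ring
    have hid : (f (γ τ + t • e) - f (γ τ)) - (f (x + t • e) - f x) =
        (f (γ τ + t • e) - f (x + t • e)) - (f (γ τ) - f x) := by ring
    rw [hid]
    refine (abs_sub _ _).trans ?_
    have : 0 ≤ r * L * |t| := by positivity
    linarith
  rcases lt_or_ge (τ + t) (-s) with h1 | h1
  · have h3 : |t| = -t := abs_of_neg (by linarith)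
    have h4 : |-s - τ| = s + τ := by rw [abs_of_nonpos (by linarith)]; ring
    exact abs_increment_sub_le_of_exterior hL hf hr hr1 hs happrox hτs htr
      (by rw [h3, h4]; linarith) (by rw [h3]; linarith) (hγe _ _) hγa hha
      (hslope _ ⟨le_rfl, by linarith⟩) hQr
  rcases lt_or_ge s (τ + t) with h2 | h2
  · have h3 : |t| = t := abs_of_pos (by linarith)
    have h4 : |s - τ| = s - τ := abs_of_nonneg (by linarith)
    exact abs_increment_sub_le_of_exterior hL hf hr hr1 hs happrox hτs htr
      (by rw [h3, h4]; linarith) (by rw [h3]; linarith) (hγe _ _) hγb hhb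
      (hslope _ ⟨by linarith, le_rfl⟩) hQr
  have h3 := hslope (τ + t) ⟨h1, h2⟩
  have h4 := hγe (τ + t) τ
  rw [add_sub_cancel_left] at h3 h4
  have h5 := happrox t (by
    have : s * (1.4 / r) = 1.4 * (s / r) := by ring
    rw [this]; linarith)
  have h6 : |f (γ τ + t • e) - f (γ (τ + t))| ≤ 2.01 * (r * L * |t|) := by
    refine (hf _ _).trans ?_
    rw [norm_sub_rev, ← sub_sub]
    calc L * ‖γ (τ + t) - γ τ - t • e‖ ≤ L * (2.01 * r * |t|) := by gcongr
      _ = _ := by ring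
  have h7 : r ^ 4 * L * |t| ≤ r * L * |t| := by
    have : r ^ 4 ≤ r ^ 1 := pow_le_pow_of_le_one hr.le (by linarith) (by norm_num)
    rw [pow_one] at this
    gcongr
  have hid : (f (γ τ + t • e) - f (γ τ)) - (f (x + t • e) - f x) =
      (f (γ τ + t • e) - f (γ (τ + t))) + (f (γ (τ + t)) - f (γ τ) - fd * t) -
      (f (x + t • e) - f x - fd * t) := by ring
  rw [hid]
  have : 0 ≤ r * L * |t| := by positivity
  rw [abs_le] at h3 h5 h6 ⊢
  constructor <;> linarith

set_option maxHeartbeats 1000000 in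
theorem exists_hasDirDeriv_increment {f : H → ℝ} {L r : ℝ} (hL : 0 < L)
    (hf : ∀ x y, |f x - f y| ≤ L * ‖x - y‖) (hr : 0 < r) (hr1 : r ≤ 1 / 240)
    {x e : H} (he : ‖e‖ = 1) {s fd : ℝ} (hs : 0 < s) (hfd0 : 0 ≤ fd)
    (happrox : ∀ t : ℝ, |t| ≤ s * (1.4 / r) →
      |f (x + t • e) - f x - fd * t| ≤ r ^ 4 * L / 160 * |t|)
    {ξ : ℝ} (hξ : ξ ∈ Set.Ioo (-(s / 2)) (s / 2)) {y s₁ s₂ : H}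
    (hs₁ : ‖s₁ - s • e‖ ≤ r ^ 4 * s / 320) (hs₂ : ‖s₂ - s • e‖ ≤ r ^ 4 * s / 320)
    (hy : ‖y - ξ • e‖ ≤ r * s + r ^ 2 * s / 16)
    (hy₁ : ‖s₁ + y‖ ≤ (1 + 0.4 * r ^ 2) * (s + ξ))
    (hy₂ : ‖s₂ - y‖ ≤ (1 + 0.4 * r ^ 2) * (s - ξ))
    (hbump : 239.9 * (r ^ 2 * L * s) ≤ |f (x + y) - f (x + ξ • e)|) :
    ∃ x' ∈ segment ℝ (x - s₁) (x + y) ∪ segment ℝ (x + y) (x + s₂),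
      ∃ e' : H, ‖e'‖ = 1 ∧ ∃ fd' : ℝ, HasDirDeriv f x' e' fd' ∧
        fd + r ^ 2 * L ≤ fd' ∧
        ∀ t : ℝ, |(f (x' + t • e) - f x') - (f (x + t • e) - f x)| ≤
          25 * √((fd' - fd) * L) * |t| := by
  obtain ⟨hξ1, hξ2⟩ := hξ
  have hr2 : r ^ 2 ≤ 1 / 57600 := by nlinarith
  have hr4 : r ^ 4 ≤ 1 / 57600 * r ^ 2 := by nlinarith [sq_nonneg r]
  have hrr : r ^ 2 ≤ 1 / 240 * r := by nlinarith
  have hp1 : 0 < s + ξ := by linarith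
  have hp2 : 0 < s - ξ := by linarith
  have hE : 0 < r ^ 2 * L := by positivity
  have hEs : 0 < r ^ 2 * L * s := by positivity
  set v₁ : H := (s + ξ)⁻¹ • (s₁ + y) with hv₁
  set v₂ : H := (s - ξ)⁻¹ • (s₂ - y) with hv₂
  have hsmall : r ^ 4 * s / 320 + (r * s + r ^ 2 * s / 16) ≤ 1.005 * r * s := by
    have := mul_le_mul_of_nonneg_right hr4 hs.le
    have := mul_le_mul_of_nonneg_right hrr hs.le
    nlinarith [mul_pos hr hs]
  have hrs : 0 < r * s := mul_pos hr hs
  have hv₁e : ‖v₁ - e‖ ≤ 2.01 * r := by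
    refine norm_inv_smul_sub_le hp1 ?_
    have h1 : s₁ + y - (s + ξ) • e = (s₁ - s • e) + (y - ξ • e) := by module
    have h2 : r * (s / 2) ≤ r * (s + ξ) := by gcongr; linarith
    rw [h1]
    exact (norm_add_le _ _).trans (by linarith)
  have hv₂e : ‖v₂ - e‖ ≤ 2.01 * r := by
    refine norm_inv_smul_sub_le hp2 ?_
    have h1 : s₂ - y - (s - ξ) • e = (s₂ - s • e) - (y - ξ • e) := by module
    have h2 : r * (s / 2) ≤ r * (s - ξ) := by gcongr; linarith
    rw [h1]
    exact (norm_sub_le _ _).trans (by linarith)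
  have hv₁n : ‖v₁‖ ≤ 1 + 0.4 * r ^ 2 := by
    rw [hv₁, norm_smul, Real.norm_of_nonneg (by positivity), inv_mul_le_iff₀ hp1]
    linarith
  have hv₂n : ‖v₂‖ ≤ 1 + 0.4 * r ^ 2 := by
    rw [hv₂, norm_smul, Real.norm_of_nonneg (by positivity), inv_mul_le_iff₀ hp2]
    linarith
  set γ : ℝ → H := brokenLine (x + y) v₁ v₂ ξ with hγ
  have hγa : γ (-s) = x - s₁ := by
    rw [hγ, brokenLine_of_le _ _ _ (by linarith), hv₁, smul_smul]
    have : (-s - ξ) * (s + ξ)⁻¹ = -1 := by field_simp; ring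
    rw [this]
    module
  have hγb : γ s = x + s₂ := by
    rw [hγ, brokenLine_of_ge _ _ _ (by linarith), hv₂, smul_smul]
    have : (s - ξ) * (s - ξ)⁻¹ = 1 := by field_simp
    rw [this]
    module
  have hγξ : γ ξ = x + y := by
    rw [hγ, brokenLine_of_le _ _ _ le_rfl]; simp
  have hγe : ∀ t u, ‖γ t - γ u - (t - u) • e‖ ≤ 2.01 * r * |t - u| :=
    norm_brokenLine_sub_le _ hv₁e hv₂e
  have hγl : ∀ t u, ‖γ t - γ u‖ ≤ (1 + 0.4 * r ^ 2) * |t - u| := fun t u => by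
    have := norm_brokenLine_sub_le (e := 0) (x + y) (ξ := ξ) (by simpa using hv₁n)
      (by simpa using hv₂n) t u
    simpa using this
  have hγa' : ‖γ (-s) - (x + (-s) • e)‖ ≤ r ^ 4 * s / 320 := by
    rw [hγa, ← norm_neg]
    refine le_of_eq_of_le ?_ hs₁
    congr 1
    module
  have hγb' : ‖γ s - (x + s • e)‖ ≤ r ^ 4 * s / 320 := by
    rw [hγb]
    simpa using hs₂
  have hsr : s ≤ s * (1.4 / r) := by
    refine le_mul_of_one_le_right hs.le ?_
    rw [le_div_iff₀ hr]; linarith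
  set h : ℝ → ℝ := fun t => f (γ t) - f x - fd * t with hh
  have hr4Ls : 1 / 100 * (r ^ 4 * L * s) ≤ 1 / 1000 * (r ^ 2 * L * s) := by
    nlinarith [mul_le_mul_of_nonneg_right hr4 (mul_pos hL hs).le]
  have hha : |h (-s)| ≤ 1 / 100 * (r ^ 4 * L * s) :=
    abs_endpoint_sub_le hL hf hr hs (by rw [abs_neg, abs_of_pos hs])
      (happrox _ (by rwa [abs_neg, abs_of_pos hs])) hγa'
  have hhb : |h s| ≤ 1 / 100 * (r ^ 4 * L * s) :=
    abs_endpoint_sub_le hL hf hr hs (abs_of_pos hs)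
      (happrox _ (by rwa [abs_of_pos hs])) hγb'
  have hξs : |ξ| ≤ s / 2 := abs_le.2 ⟨hξ1.le, hξ2.le⟩
  have hhξ : 239.8 * (r ^ 2 * L * s) ≤ |h ξ| := by
    have h1 := happrox ξ (by linarith)
    have h2 : f (x + y) - f (x + ξ • e) = h ξ - (f (x + ξ • e) - f x - fd * ξ) := by
      simp only [hh, hγξ]; ring
    rw [h2] at hbump
    have h3 := abs_sub (h ξ) (f (x + ξ • e) - f x - fd * ξ)
    have h4 : r ^ 4 * L / 160 * |ξ| ≤ r ^ 4 * L / 160 * (s / 2) := by gcongr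
    linarith
  have hfγ : ∀ t u, |f (γ t) - f (γ u)| ≤ (1.01 * L) * |t - u| := fun t u => by
    refine (hf _ _).trans ?_
    have h1 := hγl t u
    have h2 : (1 + 0.4 * r ^ 2) * |t - u| ≤ 1.01 * |t - u| := by
      gcongr; linarith
    calc L * ‖γ t - γ u‖ ≤ L * (1.01 * |t - u|) := by gcongr; exact h1.trans h2
      _ = _ := by ring
  have hfγL : LipschitzWith (Real.toNNReal (1.01 * L)) (fun t => f (γ t)) :=
    LipschitzWith.of_dist_le' fun t u => by simpa [Real.dist_eq] using hfγ t u
  have hhL : LipschitzWith (Real.toNNReal (1.01 * L + fd)) h :=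
    LipschitzWith.of_dist_le' fun t u => by
      rw [Real.dist_eq, Real.dist_eq]
      have h1 : h t - h u = (f (γ t) - f (γ u)) - fd * (t - u) := by simp only [hh]; ring
      rw [h1]
      refine (abs_sub _ _).trans ?_
      rw [abs_mul, abs_of_nonneg hfd0]
      linarith [hfγ t u]
  have hderiv : ∀ τ, DifferentiableAt ℝ h τ →
      HasDerivAt (fun t => f (γ t)) (deriv h τ + fd) τ := fun τ hτ => by
    have h1 := (hτ.hasDerivAt.add ((hasDerivAt_id τ).const_mul fd)).add_const (f x)
    simp only [mul_one] at h1
    refine h1.congr_of_eventuallyEq (Eventually.of_forall fun t => ?_)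
    simp [hh]
  have hP : ∀ τ ∈ Set.Icc (-s) s, τ ≠ ξ → DifferentiableAt ℝ h τ → deriv h τ ≤ 1.01 * L := by
    intro τ _ _ hτ
    have h1 := norm_deriv_le_of_lipschitz hfγL (x₀ := τ)
    rw [(hderiv τ hτ).deriv, Real.coe_toNNReal _ (by positivity)] at h1
    linarith [(abs_le.1 h1).2]
  have hsL : 0 < √L := Real.sqrt_pos.2 hL
  have hsqL : √L * √L = L := Real.mul_self_sqrt hL.le
  have hsP : √(1.01 * L) ≤ 1.01 * √L := by
    rw [Real.sqrt_le_left (by positivity), mul_pow, Real.sq_sqrt hL.le]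
    nlinarith
  have hq : 16 * √(1.01 * L) / (20 * √L) ≤ 0.81 := by
    rw [div_le_iff₀ (by positivity)]
    linarith
  obtain ⟨τ, ⟨hτ1, hτ2⟩, hτξ, hτd, hτc, hτs⟩ :=
    hhL.exists_deriv_controls_slopes_of_bump (a := -s) (b := s) (ξ := ξ) (c := 5 * (r ^ 2 * L))
      (w := 10 * r ^ 2 * s) (P := 1.01 * L) (D := 20 * √L) (m := 1 / 1000 * (r ^ 2 * L * s))
      ⟨by linarith, by linarith⟩ (by positivity) (by positivity) (by positivity) (by positivity)
      hP (hha.trans hr4Ls) (hhb.trans hr4Ls) (by linarith) (by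
        have h1 : 16 * √(1.01 * L) / (20 * √L) * (1 / 1000 * (r ^ 2 * L * s)) ≤
            0.81 * (1 / 1000 * (r ^ 2 * L * s)) := by gcongr
        have h2 : 0.19 * (239.7 * (r ^ 2 * L * s)) ≤ (1 - 16 * √(1.01 * L) / (20 * √L)) *
            (|h ξ| - 1 / 1000 * (r ^ 2 * L * s)) :=
          mul_le_mul (by linarith) (by linarith) (by positivity) (by linarith)
        linarith only [h1, h2, hEs])
  set d := deriv h τ with hd
  have hw0 : 0 < 10 * r ^ 2 * s := by positivity
  have hτI : τ ∈ Set.Icc (-s) s := ⟨by linarith, by linarith⟩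
  obtain ⟨v, hv, hev⟩ := brokenLine_eventuallyEq (x + y) v₁ v₂ hτξ
  have hve : ‖v - e‖ ≤ 2.01 * r := by rcases hv with rfl | rfl <;> assumption
  have hvn : ‖v‖ ≤ 1 + 0.4 * r ^ 2 := by rcases hv with rfl | rfl <;> assumption
  have hv0 : 0 < ‖v‖ := by
    have h1 := norm_sub_norm_le e v
    rw [norm_sub_rev] at h1
    linarith
  have hdir : HasDirDeriv f (γ τ) (‖v‖⁻¹ • v) ((d + fd) * ‖v‖⁻¹) := by
    apply HasDerivAt.hasDirDeriv_normalized
    have h1 : HasDerivAt (fun t => f (γ τ + (t - τ) • v)) (d + fd) τ := by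
      refine (hderiv τ hτd).congr_of_eventuallyEq ?_
      filter_upwards [hev] with t ht
      rw [hγ, ht]
    have h2 : HasDerivAt (fun t => f (γ τ + (t - τ) • v)) (d + fd) (0 + τ) := by simpa using h1
    have h3 := h2.comp_add_const 0 τ
    simpa using h3
  have he' : ‖‖v‖⁻¹ • v‖ = 1 := norm_smul_inv_norm (𝕜 := ℝ) (norm_pos_iff.1 hv0)
  set fd' := (d + fd) * ‖v‖⁻¹ with hfd'
  have hfd'L : fd' ≤ L := by simpa [he'] using hdir.le_of_lipschitz hf
  have hp : d + fd = fd' * ‖v‖ := by rw [hfd']; field_simp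
  have hfd'0 : 0 ≤ fd' := mul_nonneg (by linarith) (inv_nonneg.2 hv0.le)
  have hdle : d + fd ≤ fd' + 0.4 * (r ^ 2 * L) := by
    rw [hp]
    calc fd' * ‖v‖ ≤ fd' * (1 + 0.4 * r ^ 2) := by gcongr
      _ = fd' + 0.4 * (r ^ 2 * fd') := by ring
      _ ≤ _ := by gcongr
  have hgap : 4.6 * (r ^ 2 * L) ≤ fd' - fd := by linarith
  set Q := √((fd' - fd) * L) with hQ
  have hQr : 2 * (r * L) ≤ Q := by
    apply Real.le_sqrt_of_sq_le
    have h1 := mul_le_mul_of_nonneg_right hgap hL.le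
    have h2 : 0 ≤ r ^ 2 * L * L := by positivity
    linarith only [h1, h2]
  have hgL : 0 ≤ (fd' - fd) * L := mul_nonneg (by linarith only [hgap, hE]) hL.le
  have hQd : 20 * √L * √d ≤ 21 * Q := by
    have h1 : √L * √d ≤ 1.05 * Q := by
      rw [← Real.sqrt_mul hL.le, Real.sqrt_le_left (by positivity), mul_pow, hQ,
        Real.sq_sqrt hgL]
      have h2 : d ≤ 1.1 * (fd' - fd) := by linarith only [hdle, hgap, hE]
      have h3 := mul_le_mul_of_nonneg_left h2 hL.le
      linarith only [h3, hgL]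
    linarith
  refine ⟨γ τ, ?_, _, he', fd', hdir, by linarith, fun t => ?_⟩
  · have h1 := brokenLine_mem_segment (x + y) v₁ v₂ (ξ := ξ) (a := -s) (b := s)
      ⟨by linarith, by linarith⟩ hτI
    rwa [← hγ, hγa, hγb] at h1
  refine abs_increment_sub_le hL hf hr hr1 he hs happrox hγe hγa' hγb' hha hhb
    (τ := τ) (by linarith) (by linarith) (fun u hu => ?_) hQr t
  have h1 : f (γ u) - f (γ τ) - fd * (u - τ) = h u - h τ := by simp only [hh]; ring
  rw [h1]
  exact (hτs u hu).trans (by gcongr)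

end

theorem stmt13 {H : Type*} [NormedAddCommGroup H] [InnerProductSpace ℝ H] [CompleteSpace H]
    (f : H → ℝ) (hlip : ∃ K : NNReal, LipschitzWith K f) (hL : 0 < lipConst f)
    (ε : ℝ) (hε0 : 0 < ε) (hε : ε < lipConst f / 9)
    (x e : H) (he : ‖e‖ = 1) (s : ℝ) (hs : 0 < s)
    (fd : ℝ) (hfd : HasDirDeriv f x e fd) (hfd0 : 0 ≤ fd)
    (happrox : ∀ t : ℝ, |t| ≤ s * Real.sqrt (2 * lipConst f / ε) →
      |f (x + t • e) - f x - fd * t| ≤ ε ^ 2 / (160 * lipConst f) * |t|)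
    (ξ : ℝ) (hξ : ξ ∈ Set.Ioo (-(s / 2)) (s / 2)) (lam : H)
    (h160 : 240 * ε * s ≤ |f (x + lam) - f (x + ξ • e)|)
    (hlamξ : ‖lam - ξ • e‖ ≤ s * Real.sqrt (ε / lipConst f))
    (hup : ∀ π : ℝ, π = 1 ∨ π = -1 →
      ‖π • s • e + lam‖ / |π * s + ξ| ≤ 1 + ε / (4 * lipConst f))
    (s₁ s₂ lam' : H)
    (hs12 : max ‖s₁ - s • e‖ ‖s₂ - s • e‖ ≤ ε ^ 2 / (320 * lipConst f ^ 2) * s)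
    (hlam' : ‖lam' - lam‖ ≤ ε * s / (16 * lipConst f)) :
    ∃ x' ∈ segment ℝ (x - s₁) (x + lam') ∪ segment ℝ (x + lam') (x + s₂),
      ∃ e' : H, ‖e'‖ = 1 ∧ ∃ fd' : ℝ, HasDirDeriv f x' e' fd' ∧
        fd + ε ≤ fd' ∧
        ∀ t : ℝ, |(f (x' + t • e) - f x') - (f (x + t • e) - f x)| ≤
          25 * Real.sqrt ((fd' - fd) * lipConst f) * |t| := by
  set L := lipConst f
  have hf : ∀ x y, |f x - f y| ≤ L * ‖x - y‖ := abs_sub_le_lipConst_mul hlip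
  obtain ⟨r, hr, hrε, hrs⟩ : ∃ r : ℝ, 0 < r ∧ ε = r ^ 2 * L ∧ √(ε / L) = r :=
    ⟨√(ε / L), Real.sqrt_pos.2 (by positivity),
      by rw [Real.sq_sqrt (by positivity)]; field_simp, rfl⟩
  rw [hrs] at hlamξ
  clear hrs
  subst hrε
  have hLs : 0 < L * s := mul_pos hL hs
  have hr1 : r ≤ 1 / 240 := by
    have h1 := h160.trans (hf _ _)
    rw [add_sub_add_left_eq_sub] at h1
    have h2 : 240 * (r ^ 2 * L) * s ≤ L * (s * r) := h1.trans (by gcongr)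
    have h3 : (240 * r) * (r * (L * s)) ≤ 1 * (r * (L * s)) := by linarith
    have := le_of_mul_le_mul_right h3 (by positivity)
    linarith
  have hr2 : r ^ 4 ≤ 1 / 57600 * r ^ 2 := by
    have : r ^ 2 ≤ 1 / 57600 := by nlinarith
    nlinarith [sq_nonneg r]
  have hr2s : 0 < r ^ 2 * s := by positivity
  have hr4s := mul_le_mul_of_nonneg_right hr2 hs.le
  have e1 : (r ^ 2 * L) ^ 2 / (160 * L) = r ^ 4 * L / 160 := by field_simp
  have e2 : (r ^ 2 * L) ^ 2 / (320 * L ^ 2) * s = r ^ 4 * s / 320 := by field_simp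
  have e3 : r ^ 2 * L * s / (16 * L) = r ^ 2 * s / 16 := by field_simp
  have e4 : r ^ 2 * L / (4 * L) = r ^ 2 / 4 := by field_simp
  rw [e1] at happrox
  rw [e2] at hs12
  rw [e3] at hlam'
  rw [e4] at hup
  have hs₁ := (le_max_left _ _).trans hs12
  have hs₂ := (le_max_right _ _).trans hs12
  have hξ' := hξ
  obtain ⟨hξ1, hξ2⟩ := hξ'
  have hp1 : 0 < s + ξ := by linarith
  have hp2 : 0 < s - ξ := by linarith
  have hq1 : r ^ 2 * (s / 2) ≤ r ^ 2 * (s + ξ) := by gcongr; linarith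
  have hq2 : r ^ 2 * (s / 2) ≤ r ^ 2 * (s - ξ) := by gcongr; linarith
  refine exists_hasDirDeriv_increment hL hf hr hr1 he hs hfd0 (fun t ht => happrox t (ht.trans ?_))
    hξ hs₁ hs₂ ?_ ?_ ?_ ?_
  · refine mul_le_mul_of_nonneg_left (Real.le_sqrt_of_sq_le ?_) hs.le
    rw [div_pow, div_le_div_iff₀ (by positivity) (by positivity)]
    have : 0 < L * r ^ 2 := by positivity
    linarith
  · have h1 : lam' - ξ • e = (lam - ξ • e) + (lam' - lam) := by abel
    rw [h1]
    refine (norm_add_le _ _).trans ?_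
    linarith
  · have h1 := hup 1 (Or.inl rfl)
    rw [one_smul, one_mul, abs_of_pos hp1, div_le_iff₀ hp1] at h1
    have h2 : s₁ + lam' = (s • e + lam) + (s₁ - s • e) + (lam' - lam) := by abel
    rw [h2]
    refine (norm_add₃_le).trans ?_
    linarith
  · have h1 := hup (-1) (Or.inr rfl)
    rw [show -1 * s + ξ = -(s - ξ) by ring, abs_neg, abs_of_pos hp2, div_le_iff₀ hp2,
      show (-1 : ℝ) • s • e + lam = -(s • e - lam) by module, norm_neg] at h1
    have h2 : s₂ - lam' = (s • e - lam) + (s₂ - s • e) - (lam' - lam) := by abel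
    rw [h2]
    refine (norm_sub_le _ _).trans ((add_le_add (norm_add_le _ _) le_rfl).trans ?_)
    linarith
  · have h1 := hf (x + lam) (x + lam')
    rw [add_sub_add_left_eq_sub, norm_sub_rev] at h1
    have h2 := abs_sub_le (f (x + lam)) (f (x + lam')) (f (x + ξ • e))
    have h3 := mul_le_mul_of_nonneg_left hlam' hL.le
    have : 0 < r ^ 2 * L * s := by positivity
    linarith
end
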